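/- In a d-regular graph of girth g with g̃ = ⌈g/2⌉ − 1, let (X_t) be SRW started at x with X_1 = u where u is a neighbor of x, conditioned to never return to the finite set A ∋ x. If P_x(X_1 = u and X_t ∉ A for all t > 0) ≥ α·(1/d) · d = α (i.e., the escape probability through u is at least α), then the edge (x,u) is (α,A)-good: since the ball B(u,g̃) is a tree, the first g̃ steps of the loop-erasure of the walk killed on exiting B(u,g̃) give a uniformly random non-backtracking path of length g̃ from u, so at least an α fraction of the non-backtracking paths of length g̃ from u (not starting back at x) avoid A. -/

import Mathlib

open MeasureTheory

/-- Non-backtracking paths of length `k` in `G` starting at `u`, encoded as functions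
`ℕ → V` that are constant past time `k`. -/
def NBPathsFrom {V : Type*} (G : SimpleGraph V) (u : V) (k : ℕ) : Set (ℕ → V) :=
  {p | p 0 = u ∧ (∀ i, i < k → G.Adj (p i) (p (i + 1))) ∧
    (∀ i, i + 2 ≤ k → p (i + 2) ≠ p i) ∧ ∀ i, k ≤ i → p i = p k}

/-- The directed edge `(x, u)` is `(α, A)`-good: `x ∈ A` and at least an `α` fraction of the
`(d-1)^k` non-backtracking paths of length `k` emanating from `u` whose first step is not `x`
avoid `A` entirely. -/
def IsGoodEdge {V : Type*} (G : SimpleGraph V) (d k : ℕ) (α : ℝ) (A : Set V) (x u : V) :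
    Prop :=
  x ∈ A ∧ G.Adj x u ∧
    α * ((d : ℝ) - 1) ^ k ≤
      ({p ∈ NBPathsFrom G u k | p 1 ≠ x ∧ ∀ i, p i ∉ A}.ncard : ℝ)

open scoped Classical in
/-- `μ x` is the law on path space `ℕ → V` of the Markov chain with transition kernel `P`
started at `x`: cylinder sets have the product probabilities. -/
def IsMarkovPathLaw {V : Type*} [MeasurableSpace V] (P : V → V → ℝ)
    (μ : V → Measure (ℕ → V)) : Prop :=
  (∀ x, IsProbabilityMeasure (μ x)) ∧
    ∀ (x : V) (n : ℕ) (path : ℕ → V),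
      μ x {ω | ∀ i ≤ n, ω i = path i} =
        (if path 0 = x then 1 else 0) *
          ∏ i ∈ Finset.range n, ENNReal.ofReal (P (path i) (path (i + 1)))

open Filter Topology

section NonBacktracking

variable {V : Type*} {G : SimpleGraph V} {A : Set V} {k : ℕ} {v w : V} {p : ℕ → V}

/-- Prepend the vertex `v` to the path `p`. -/
def consPath (v : V) (p : ℕ → V) : ℕ → V
  | 0 => v
  | n + 1 => p n

theorem consPath_injective (v : V) : Function.Injective (consPath v) :=
  fun _ _ h => funext fun n => congrFun h (n + 1)

/-- The non-backtracking paths of length `k` from `v` whose first step is not `w` and which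
avoid `A`. -/
def avoidingNBPaths (G : SimpleGraph V) (A : Set V) (k : ℕ) (w v : V) : Set (ℕ → V) :=
  {p ∈ NBPathsFrom G v k | p 1 ≠ w ∧ ∀ i, p i ∉ A}

theorem finite_NBPathsFrom [G.LocallyFinite] (v : V) (k : ℕ) : (NBPathsFrom G v k).Finite := by
  induction k generalizing v with
  | zero =>
    refine (Set.finite_singleton fun _ => v).subset ?_
    rintro p ⟨h0, -, -, hc⟩
    funext i
    rw [hc i (Nat.zero_le i), h0]
  | succ k ih =>
    refine ((G.neighborFinset v).finite_toSet.biUnion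
      fun c _ => (ih c).image (consPath v)).subset ?_
    rintro p ⟨h0, ha, hb, hc⟩
    simp only [Set.mem_iUnion]
    refine ⟨p 1, ?_, fun n => p (n + 1), ?_, ?_⟩
    · have := ha 0 (Nat.succ_pos k)
      rw [h0] at this
      simpa using this
    · exact ⟨rfl, fun i hi => ha (i + 1) (by omega), fun i hi => hb (i + 1) (by omega),
        fun i hi => hc (i + 1) (by omega)⟩
    · funext n
      cases n with
      | zero => exact h0.symm
      | succ n => rfl

theorem finite_avoidingNBPaths [G.LocallyFinite] (A : Set V) (k : ℕ) (w v : V) :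
    (avoidingNBPaths G A k w v).Finite :=
  (finite_NBPathsFrom v k).subset fun _ h => h.1

theorem one_le_ncard_avoidingNBPaths_zero [G.LocallyFinite] (hv : v ∉ A) (hvw : v ≠ w) :
    1 ≤ (avoidingNBPaths G A 0 w v).ncard := by
  rw [Nat.one_le_iff_ne_zero, ← Nat.pos_iff_ne_zero, Set.ncard_pos (finite_avoidingNBPaths A 0 w v)]
  exact ⟨fun _ => v, ⟨rfl, by simp, by simp, by simp⟩, hvw, fun _ => hv⟩

theorem consPath_mem_avoidingNBPaths {c : V} (hv : v ∉ A) (hadj : G.Adj v c) (hcw : c ≠ w)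
    (hp : p ∈ avoidingNBPaths G A k v c) : consPath v p ∈ avoidingNBPaths G A (k + 1) w v := by
  obtain ⟨⟨h0, ha, hb, hc⟩, h1, hA⟩ := hp
  refine ⟨⟨rfl, ?_, ?_, ?_⟩, ?_, ?_⟩
  · rintro (_ | i) hi
    · simpa [consPath, h0] using hadj
    · exact ha i (by omega)
  · rintro (_ | i) hi
    · exact h1
    · exact hb i (by omega)
  · rintro (_ | i) hi
    · omega
    · exact hc i (by omega)
  · simpa [consPath, h0] using hcw
  · rintro (_ | i)
    · exact hv
    · exact hA i

open scoped Classical in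
theorem sum_ncard_avoidingNBPaths_le [G.LocallyFinite] (hv : v ∉ A) :
    ∑ c ∈ (G.neighborFinset v).erase w, (avoidingNBPaths G A k v c).ncard ≤
      (avoidingNBPaths G A (k + 1) w v).ncard := by
  have hfin := fun c => finite_avoidingNBPaths (G := G) A k v c
  rw [Set.ncard_eq_toFinset_card _ (finite_avoidingNBPaths A (k + 1) w v)]
  calc ∑ c ∈ (G.neighborFinset v).erase w, (avoidingNBPaths G A k v c).ncard
      = ((((G.neighborFinset v).erase w)).sigma fun c => (hfin c).toFinset).card := by
        rw [Finset.card_sigma]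
        exact Finset.sum_congr rfl fun c _ => Set.ncard_eq_toFinset_card _ (hfin c)
    _ ≤ _ := by
        refine Finset.card_le_card_of_injOn (fun s => consPath v s.2) ?_ ?_
        · rintro ⟨c, p⟩ h
          simp only [Finset.coe_sigma, Set.mem_sigma_iff, Finset.mem_coe, Finset.mem_erase,
            SimpleGraph.mem_neighborFinset, Set.Finite.mem_toFinset] at h ⊢
          exact consPath_mem_avoidingNBPaths hv h.1.2 h.1.1 h.2
        · rintro ⟨c, p⟩ h ⟨c', p'⟩ h' heq
          simp only [Finset.coe_sigma, Set.mem_sigma_iff, Finset.mem_coe,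
            Set.Finite.mem_toFinset] at h h'
          obtain rfl : p = p' := consPath_injective v heq
          obtain rfl : c = c' := h.2.1.1.symm.trans h'.2.1.1
          rfl

end NonBacktracking

section Harmonic

variable {V : Type*} {G : SimpleGraph V} [G.LocallyFinite] {A : Set V} {d : ℕ}

open scoped Classical in
/-- A function that vanishes on `A`, is at most `1` and is harmonic off `A` is bounded at `v`
by a convex combination of its value at a neighbour `w` and the fraction of non-backtracking
paths from `v`, first step not `w`, that avoid `A`. -/
theorem exists_le_convex_comb_ncard_avoidingNBPaths (hreg : G.IsRegularOfDegree d) {f : V → ℝ}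
    (hnonneg : ∀ v, 0 ≤ f v) (hle : ∀ v, f v ≤ 1) (hzero : ∀ v ∈ A, f v = 0)
    (hharm : ∀ v ∉ A, d * f v = ∑ c ∈ G.neighborFinset v, f c) (k : ℕ) :
    ∃ a : ℝ, 0 ≤ a ∧ a ≤ 1 ∧ ∀ w v, G.Adj w v →
      f v * ((d : ℝ) - 1) ^ k ≤
        a * (f w * ((d : ℝ) - 1) ^ k) + (1 - a) * ((avoidingNBPaths G A k w v).ncard : ℝ) := by
  induction k with
  | zero =>
    refine ⟨0, le_rfl, zero_le_one, fun w v hwv => ?_⟩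
    by_cases hv : v ∈ A
    · simp [hzero v hv]
    · have : (1 : ℝ) ≤ (avoidingNBPaths G A 0 w v).ncard := by
        exact_mod_cast one_le_ncard_avoidingNBPaths_zero hv hwv.ne'
      simpa using (hle v).trans this
  | succ k ih =>
    obtain ⟨a, ha0, ha1, h⟩ := ih
    by_cases hd : d = 0
    · refine ⟨0, le_rfl, zero_le_one, fun w v hwv => ?_⟩
      have := hreg w
      rw [hd, G.degree_eq_zero_iff_notMem_support] at this
      exact absurd ⟨v, hwv⟩ this
    have hD : (0 : ℝ) ≤ (d : ℝ) - 1 := by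
      rw [sub_nonneg]
      exact_mod_cast Nat.one_le_iff_ne_zero.2 hd
    set D : ℝ := (d : ℝ) - 1 with hDdef
    have hDa : 0 ≤ D * (1 - a) := mul_nonneg hD (by linarith)
    have ht : 0 < 1 + D * (1 - a) := by linarith
    have hcompl : 1 - 1 / (1 + D * (1 - a)) = D * (1 - a) / (1 + D * (1 - a)) := by
      field_simp
      ring
    refine ⟨1 / (1 + D * (1 - a)), by positivity, ?_, fun w v hwv => ?_⟩
    · rw [div_le_one ht]
      linarith
    rw [hcompl]
    by_cases hv : v ∈ A
    · rw [hzero v hv, zero_mul]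
      have := hnonneg w
      positivity
    have hw : w ∈ G.neighborFinset v := by simpa using hwv.symm
    have hcard : ((((G.neighborFinset v).erase w).card : ℕ) : ℝ) = D := by
      rw [Finset.card_erase_of_mem hw, G.card_neighborFinset_eq_degree, hreg v,
        Nat.cast_pred (Nat.pos_of_ne_zero hd)]
    have hsum : ∑ c ∈ (G.neighborFinset v).erase w, f c * D ^ k ≤
        D * (a * (f v * D ^ k)) +
          (1 - a) * ((avoidingNBPaths G A (k + 1) w v).ncard : ℝ) := by
      calc ∑ c ∈ (G.neighborFinset v).erase w, f c * D ^ k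
          ≤ ∑ c ∈ (G.neighborFinset v).erase w,
              (a * (f v * D ^ k) + (1 - a) * ((avoidingNBPaths G A k v c).ncard : ℝ)) :=
            Finset.sum_le_sum fun c hc =>
              h v c ((G.mem_neighborFinset v c).1 (Finset.mem_of_mem_erase hc))
        _ = D * (a * (f v * D ^ k)) + (1 - a) *
              ((∑ c ∈ (G.neighborFinset v).erase w,
                (avoidingNBPaths G A k v c).ncard : ℕ) : ℝ) := by
            rw [Finset.sum_add_distrib, Finset.sum_const, nsmul_eq_mul, hcard,
              ← Finset.mul_sum, Nat.cast_sum]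
        _ ≤ _ := by
            have : (0 : ℝ) ≤ 1 - a := by linarith
            gcongr
            exact sum_ncard_avoidingNBPaths_le hv
    have hmean := hharm v hv
    rw [← Finset.add_sum_erase _ _ hw] at hmean
    rw [← Finset.sum_mul] at hsum
    have key := mul_le_mul_of_nonneg_left hsum hD
    have hdD : (d : ℝ) = D + 1 := by rw [hDdef]; ring
    rw [hdD] at hmean
    have hS : ∑ c ∈ (G.neighborFinset v).erase w, f c = (D + 1) * f v - f w := by linarith
    rw [hS] at key
    rw [div_mul_eq_mul_div, div_mul_eq_mul_div, ← add_div, le_div_iff₀ ht]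
    rw [pow_succ]
    linarith

end Harmonic

section AvoidanceProbability

variable {V : Type*} (G : SimpleGraph V) [G.LocallyFinite] (A : Set V)

open scoped Classical in
/-- The probability that the simple random walk on a locally finite graph started at `v` avoids
`A` at the times `0, …, n`. -/
noncomputable def avoidProb : ℕ → V → ℝ
  | 0, v => if v ∈ A then 0 else 1
  | n + 1, v => if v ∈ A then 0 else (∑ c ∈ G.neighborFinset v, avoidProb n c) / G.degree v

theorem avoidProb_of_mem {v : V} (hv : v ∈ A) (n : ℕ) : avoidProb G A n v = 0 := by
  cases n <;> simp [avoidProb, hv]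

theorem avoidProb_nonneg (n : ℕ) (v : V) : 0 ≤ avoidProb G A n v := by
  induction n generalizing v with
  | zero => rw [avoidProb]; split_ifs <;> norm_num
  | succ n ih =>
    rw [avoidProb]
    split_ifs
    · exact le_rfl
    · exact div_nonneg (Finset.sum_nonneg fun c _ => ih c) (Nat.cast_nonneg _)

theorem avoidProb_le_one (n : ℕ) (v : V) : avoidProb G A n v ≤ 1 := by
  induction n generalizing v with
  | zero => rw [avoidProb]; split_ifs <;> norm_num
  | succ n ih =>
    rw [avoidProb]
    split_ifs
    · exact zero_le_one
    · refine div_le_one_of_le₀ ?_ (Nat.cast_nonneg _)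
      calc ∑ c ∈ G.neighborFinset v, avoidProb G A n c
          ≤ ∑ _c ∈ G.neighborFinset v, (1 : ℝ) := Finset.sum_le_sum fun c _ => ih c
        _ = G.degree v := by simp

theorem avoidProb_antitone (v : V) : Antitone fun n => avoidProb G A n v := by
  refine antitone_nat_of_succ_le fun n => ?_
  induction n generalizing v with
  | zero =>
    by_cases hv : v ∈ A
    · simp [avoidProb_of_mem G A hv]
    · simpa [avoidProb, hv] using avoidProb_le_one G A 1 v
  | succ n ih =>
    by_cases hv : v ∈ A
    · simp [avoidProb_of_mem G A hv]
    · rw [avoidProb, avoidProb, if_neg hv, if_neg hv]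
      gcongr
      exact ih _

theorem exists_tendsto_avoidProb :
    ∃ f : V → ℝ, ∀ v, Tendsto (fun n => avoidProb G A n v) atTop (𝓝 (f v)) :=
  ⟨fun v => ⨅ n, avoidProb G A n v, fun v => tendsto_atTop_ciInf (avoidProb_antitone G A v)
    ⟨0, by rintro _ ⟨n, rfl⟩; exact avoidProb_nonneg G A n v⟩⟩

end AvoidanceProbability

section PathLaw

variable {V : Type*} [Countable V] [MeasurableSpace V]

theorem IsMarkovPathLaw.measure_compl_start {P : V → V → ℝ} {μ : V → Measure (ℕ → V)}
    (hμ : IsMarkovPathLaw P μ) (x : V) : μ x {ω | ω 0 ≠ x} = 0 := by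
  have hsub : {ω : ℕ → V | ω 0 ≠ x} ⊆
      ⋃ y : {y : V // y ≠ x}, {ω | ∀ i ≤ 0, ω i = (fun _ => (y : V)) i} := fun ω hω =>
    Set.mem_iUnion.2 ⟨⟨ω 0, hω⟩, fun i hi => by rw [Nat.le_zero.1 hi]⟩
  refine measure_mono_null hsub (measure_iUnion_null fun y => ?_)
  rw [hμ.2, if_neg y.2, zero_mul]

theorem IsMarkovPathLaw.exists_ne_zero {P : V → V → ℝ} {μ : V → Measure (ℕ → V)}
    (hμ : IsMarkovPathLaw P μ) (x : V) : ∃ y z, P y z ≠ 0 := by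
  by_contra! h
  have := hμ.1 x
  have hsub : (Set.univ : Set (ℕ → V)) ⊆
      ⋃ q : V × V, {ω | ∀ i ≤ 1, ω i = consPath q.1 (fun _ => q.2) i} := by
    intro ω _
    refine Set.mem_iUnion.2 ⟨(ω 0, ω 1), fun i hi => ?_⟩
    interval_cases i <;> rfl
  have hnull : μ x Set.univ = 0 := measure_mono_null hsub (measure_iUnion_null fun q => by
    rw [hμ.2]
    simp [h])
  simp at hnull

open scoped Classical in
theorem measure_cylinder_avoiding_le {G : SimpleGraph V} [G.LocallyFinite] {d : ℕ}
    (hreg : G.IsRegularOfDegree d) {μ : V → Measure (ℕ → V)}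
    (hμ : IsMarkovPathLaw (fun a b => if G.Adj a b then 1 / (d : ℝ) else 0) μ)
    (A : Set V) (x : V) (n m : ℕ) (p : ℕ → V) :
    μ x {ω | (∀ i ≤ m, ω i = p i) ∧ ∀ i, m ≤ i → ω i ∉ A} ≤
      μ x {ω | ∀ i ≤ m, ω i = p i} * ENNReal.ofReal (avoidProb G A n (p m)) := by
  by_cases hv : p m ∈ A
  · have hempty : {ω : ℕ → V | (∀ i ≤ m, ω i = p i) ∧ ∀ i, m ≤ i → ω i ∉ A} = ∅ := by
      ext ω
      simp only [Set.mem_ofPred_eq, Set.mem_empty_iff_false, iff_false, not_and]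
      intro h h'
      exact h' m le_rfl (by rwa [h m le_rfl])
    rw [hempty, measure_empty]
    exact zero_le
  induction n generalizing m p with
  | zero =>
    simp only [avoidProb, if_neg hv, ENNReal.ofReal_one, mul_one]
    exact measure_mono fun ω h => h.1
  | succ n ih =>
    have ih' : ∀ c : V, μ x {ω | (∀ i ≤ m + 1, ω i = Function.update p (m + 1) c i) ∧
        ∀ i, m + 1 ≤ i → ω i ∉ A} ≤ μ x {ω | ∀ i ≤ m, ω i = p i} *
          (ENNReal.ofReal (if G.Adj (p m) c then 1 / (d : ℝ) else 0) *
            ENNReal.ofReal (avoidProb G A n c)) := by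
      intro c
      have hcyl : μ x {ω | ∀ i ≤ m + 1, ω i = Function.update p (m + 1) c i} =
          μ x {ω | ∀ i ≤ m, ω i = p i} *
            ENNReal.ofReal (if G.Adj (p m) c then 1 / (d : ℝ) else 0) := by
        have hupd : ∀ i ≤ m, Function.update p (m + 1) c i = p i := fun i hi =>
          Function.update_of_ne (by omega) _ _
        rw [hμ.2, hμ.2, Finset.prod_range_succ, hupd 0 (Nat.zero_le m), hupd m le_rfl,
          Function.update_self, mul_assoc]
        congr 2
        refine Finset.prod_congr rfl fun i hi => ?_
        have hi' := Finset.mem_range.1 hi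
        rw [hupd i hi'.le, hupd (i + 1) hi']
      by_cases hc : c ∈ A
      · have hempty : {ω : ℕ → V | (∀ i ≤ m + 1, ω i = Function.update p (m + 1) c i) ∧
            ∀ i, m + 1 ≤ i → ω i ∉ A} = ∅ := by
          ext ω
          simp only [Set.mem_ofPred_eq, Set.mem_empty_iff_false, iff_false, not_and]
          intro h h'
          exact h' (m + 1) le_rfl (by rwa [h (m + 1) le_rfl, Function.update_self])
        rw [hempty, measure_empty]
        exact zero_le
      · have := ih (m + 1) (Function.update p (m + 1) c) (by rwa [Function.update_self])
        rwa [hcyl, Function.update_self, mul_assoc] at this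
    have hsub : {ω : ℕ → V | (∀ i ≤ m, ω i = p i) ∧ ∀ i, m ≤ i → ω i ∉ A} ⊆
        ⋃ c : V, {ω | (∀ i ≤ m + 1, ω i = Function.update p (m + 1) c i) ∧
          ∀ i, m + 1 ≤ i → ω i ∉ A} := by
      rintro ω ⟨h, h'⟩
      refine Set.mem_iUnion.2 ⟨ω (m + 1), fun i hi => ?_, fun i hi => h' i (by omega)⟩
      rcases hi.lt_or_eq with hi | rfl
      · rw [Function.update_of_ne hi.ne, h i (by omega)]
      · rw [Function.update_self]
    calc μ x {ω | (∀ i ≤ m, ω i = p i) ∧ ∀ i, m ≤ i → ω i ∉ A}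
        ≤ ∑' c : V, μ x {ω | (∀ i ≤ m + 1, ω i = Function.update p (m + 1) c i) ∧
            ∀ i, m + 1 ≤ i → ω i ∉ A} := (measure_mono hsub).trans (measure_iUnion_le _)
      _ ≤ ∑' c : V, μ x {ω | ∀ i ≤ m, ω i = p i} *
          (ENNReal.ofReal (if G.Adj (p m) c then 1 / (d : ℝ) else 0) *
            ENNReal.ofReal (avoidProb G A n c)) := ENNReal.tsum_le_tsum ih'
      _ = _ := by
        rw [ENNReal.tsum_mul_left]
        congr 1
        rw [tsum_eq_sum (s := G.neighborFinset (p m))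
          (fun c hc => by simp [(G.mem_neighborFinset _ _).not.1 hc]),
          avoidProb, if_neg hv, hreg (p m), Finset.sum_div, ENNReal.ofReal_sum_of_nonneg
            fun c _ => div_nonneg (avoidProb_nonneg G A n c) (Nat.cast_nonneg d)]
        refine Finset.sum_congr rfl fun c hc => ?_
        rw [if_pos ((G.mem_neighborFinset _ _).1 hc), ← ENNReal.ofReal_mul (by positivity)]
        congr 1
        ring

theorem measure_escape_le_avoidProb {G : SimpleGraph V} [G.LocallyFinite] {d : ℕ}
    (hreg : G.IsRegularOfDegree d) {μ : V → Measure (ℕ → V)}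
    (hμ : IsMarkovPathLaw (fun a b => open scoped Classical in
      if G.Adj a b then 1 / (d : ℝ) else 0) μ)
    (A : Set V) (x u : V) (n : ℕ) :
    μ x {ω | ω 1 = u ∧ ∀ t, 0 < t → ω t ∉ A} ≤ ENNReal.ofReal (avoidProb G A n u) := by
  have := hμ.1 x
  have hsub : {ω : ℕ → V | ω 1 = u ∧ ∀ t, 0 < t → ω t ∉ A} ⊆
      {ω | (∀ i ≤ 1, ω i = consPath x (fun _ => u) i) ∧ ∀ i, 1 ≤ i → ω i ∉ A} ∪
        {ω | ω 0 ≠ x} := by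
    rintro ω ⟨h1, h⟩
    by_cases h0 : ω 0 = x
    · refine Or.inl ⟨fun i hi => ?_, h⟩
      interval_cases i
      · exact h0
      · exact h1
    · exact Or.inr h0
  calc μ x {ω | ω 1 = u ∧ ∀ t, 0 < t → ω t ∉ A}
      ≤ μ x {ω | (∀ i ≤ 1, ω i = consPath x (fun _ => u) i) ∧ ∀ i, 1 ≤ i → ω i ∉ A} +
          μ x {ω | ω 0 ≠ x} := (measure_mono hsub).trans (measure_union_le _ _)
    _ = μ x {ω | (∀ i ≤ 1, ω i = consPath x (fun _ => u) i) ∧ ∀ i, 1 ≤ i → ω i ∉ A} := by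
      rw [hμ.measure_compl_start, add_zero]
    _ ≤ μ x {ω | ∀ i ≤ 1, ω i = consPath x (fun _ => u) i} *
          ENNReal.ofReal (avoidProb G A n u) :=
      measure_cylinder_avoiding_le hreg hμ A x n 1 _
    _ ≤ ENNReal.ofReal (avoidProb G A n u) := mul_le_of_le_one_left' prob_le_one

end PathLaw

open scoped Classical in
/-- in a `d`-regular graph of girth `g`, with `g̃ = ⌈g/2⌉ - 1`, if `(μ x)` is the
law of simple random walk started at `x ∈ A` (`A` a finite vertex set) and the escape
probability `P_x(X_1 = u and X_t ∉ A for all t > 0)` through the neighbour `u` of `x` is at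
least `α`, then the edge `(x, u)` is `(α, A)`-good. -/
theorem stmt_6 {V : Type*} [Countable V] [MeasurableSpace V] (G : SimpleGraph V)
    (d g : ℕ) (hreg : ∀ v, (G.neighborSet v).ncard = d) (hg : G.egirth = (g : ℕ∞))
    (gt : ℕ) (hgt : gt = (g + 1) / 2 - 1)
    (μ : V → Measure (ℕ → V))
    (hμ : IsMarkovPathLaw (fun a b => if G.Adj a b then 1 / (d : ℝ) else 0) μ)
    (A : Set V) (hAfin : A.Finite)
    (x u : V) (hx : x ∈ A) (hadj : G.Adj x u) (α : ℝ)
    (hesc : ENNReal.ofReal α ≤ μ x {ω | ω 1 = u ∧ ∀ t, 0 < t → ω t ∉ A}) :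
    IsGoodEdge G d gt α A x u := by
  have hd : d ≠ 0 := by
    rintro rfl
    obtain ⟨y, z, h⟩ := hμ.exists_ne_zero x
    simp at h
  have hfin : ∀ v, (G.neighborSet v).Finite := fun v =>
    Set.finite_of_ncard_ne_zero (by rwa [hreg v])
  let : G.LocallyFinite := fun v => (hfin v).fintype
  have hdeg : G.IsRegularOfDegree d := fun v => by
    rw [← hreg v, Set.ncard_eq_toFinset_card', ← G.card_neighborFinset_eq_degree]
    rfl
  obtain ⟨f, hf⟩ := exists_tendsto_avoidProb G A
  have hzero : ∀ v ∈ A, f v = 0 := fun v hv => tendsto_nhds_unique (hf v) <| by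
    simpa only [avoidProb_of_mem G A hv] using tendsto_const_nhds
  have hnonneg : ∀ v, 0 ≤ f v := fun v => ge_of_tendsto' (hf v) (avoidProb_nonneg G A · v)
  have hle : ∀ v, f v ≤ 1 := fun v => le_of_tendsto' (hf v) (avoidProb_le_one G A · v)
  have hharm : ∀ v ∉ A, d * f v = ∑ c ∈ G.neighborFinset v, f c := by
    intro v hv
    refine tendsto_nhds_unique (((hf v).comp (tendsto_add_atTop_nat 1)).const_mul (d : ℝ)) ?_
    refine (tendsto_finsetSum _ fun c _ => hf c).congr fun n => ?_
    have hd' : (d : ℝ) ≠ 0 := Nat.cast_ne_zero.2 hd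
    simp only [Function.comp_apply, avoidProb, if_neg hv, hdeg v]
    field_simp
  have hα : α ≤ f u := ge_of_tendsto' (hf u) fun n =>
    (ENNReal.ofReal_le_ofReal_iff (avoidProb_nonneg G A n u)).1
      (hesc.trans (measure_escape_le_avoidProb hdeg hμ A x u n))
  obtain ⟨a, ha0, -, h⟩ :=
    exists_le_convex_comb_ncard_avoidingNBPaths hdeg hnonneg hle hzero hharm gt
  have hD : (0 : ℝ) ≤ (d : ℝ) - 1 := by
    rw [sub_nonneg]
    exact_mod_cast Nat.one_le_iff_ne_zero.2 hd
  refine ⟨hx, hadj, ?_⟩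
  calc α * ((d : ℝ) - 1) ^ gt ≤ f u * ((d : ℝ) - 1) ^ gt := by gcongr
    _ ≤ (1 - a) * ((avoidingNBPaths G A gt x u).ncard : ℝ) := by
      simpa [hzero x hx] using h x u hadj
    _ ≤ ((avoidingNBPaths G A gt x u).ncard : ℝ) :=
      mul_le_of_le_one_left (Nat.cast_nonneg _) (by linarith)
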